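/- Let Γ^t be a smooth family of graphical tori with smooth defining function F : S¹ × ℂ → ℝ, extended to a smooth function F : Δ̄ × ℂ → ℝ with F(λ,w) = |w|² for all λ ∈ Δ̄ and |w| ≤ ε, and with ∂F/∂w ≠ 0 for w ≠ 0. Then there exists a function ψ : Δ̄ × ℂ → ℝ ∪ {−∞}, smooth away from {w = 0}, such that Δ_w ψ < 0 (the Laplacian of w ↦ ψ(λ,w) is negative for each fixed λ), the restriction of ψ to S¹ × ℂ defines the foliation by the tori Γ^t, ψ(λ, 0) = −∞ for all λ ∈ Δ̄, and for each |λ| = 1 one has ψ_λ^{-1}(1) = C_λ := C¹_λ. -/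

import Mathlib

open Set Metric Complex

noncomputable section

/-- Multiplication by `i` on `ℂ²`. -/
def iSmul (v : ℂ × ℂ) : ℂ × ℂ := (Complex.I * v.1, Complex.I * v.2)

/-- The Euclidean (real) inner product on `ℂ² ≅ ℝ⁴`. -/
def rInner (u v : ℂ × ℂ) : ℝ :=
  (u.1 * (starRingEnd ℂ) v.1 + u.2 * (starRingEnd ℂ) v.2).re

/-- The Euclidean norm on `ℂ² ≅ ℝ⁴`. -/
def rNorm (u : ℂ × ℂ) : ℝ := Real.sqrt (rInner u u)

/-- The Laplacian of a function `f : ℂ → ℝ` at `w`. -/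
def lap (f : ℂ → ℝ) (w : ℂ) : ℝ :=
  iteratedFDeriv ℝ 2 f w ![1, 1] + iteratedFDeriv ℝ 2 f w ![Complex.I, Complex.I]

/-- Restriction of `u : ℂ² → ℝ` to the complex line through `z` in direction `v`. -/
def lineRestr (u : ℂ × ℂ → ℝ) (z v : ℂ × ℂ) : ℂ → ℝ :=
  fun t => u (z + (t * v.1, t * v.2))

/-- `u` is smooth and strictly plurisubharmonic on `U`: its restriction to every complex
line is strictly subharmonic (positive Laplacian). -/
def StrictPSHOn (u : ℂ × ℂ → ℝ) (U : Set (ℂ × ℂ)) : Prop :=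
  ContDiffOn ℝ (⊤ : ℕ∞) u U ∧
    ∀ z ∈ U, ∀ v : ℂ × ℂ, v ≠ 0 → 0 < lap (lineRestr u z v) 0

/-- `Ω` is a bounded strictly pseudoconvex domain with defining function `ρ`: `ρ` is
smooth and strictly plurisubharmonic on a neighborhood `U` of `closure Ω` and
`Ω = {z ∈ U | ρ z < 0}`. -/
def IsStrictPseudoconvexWith (Ω : Set (ℂ × ℂ)) (ρ : ℂ × ℂ → ℝ) : Prop :=
  IsOpen Ω ∧ Ω.Nonempty ∧ Bornology.IsBounded Ω ∧
    ∃ U : Set (ℂ × ℂ), IsOpen U ∧ closure Ω ⊆ U ∧ StrictPSHOn ρ U ∧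
      Ω = {z ∈ U | ρ z < 0}

/-- The closed curve `c` (periodic of period `2π`) has winding number `1` around `0`:
there is a continuous lift of the argument increasing by `2π` over one period. -/
def WindingOne (c : ℝ → ℂ) : Prop :=
  ∃ θ : ℝ → ℝ, Continuous θ ∧
    (∀ t, c t = (‖c t‖ : ℂ) * Complex.exp ((θ t : ℂ) * Complex.I)) ∧
    θ (2 * Real.pi) = θ 0 + 2 * Real.pi

/-- `c : ℝ → ℂ` is a smooth simple closed curve (parametrized with period `2π`). -/
def IsSCC (c : ℝ → ℂ) : Prop :=
  ContDiff ℝ (⊤ : ℕ∞) c ∧ (∀ t, c (t + 2 * Real.pi) = c t) ∧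
    Set.InjOn c (Ico 0 (2 * Real.pi)) ∧ ∀ t, deriv c t ≠ 0

/-- `Γ ⊆ S¹ × ℂ` is a graphical torus: every vertical slice `C_λ` is a smooth simple
closed curve in `ℂ ∖ {0}` with winding number `1` around `0`. -/
def IsGraphicalTorus (Γ : Set (ℂ × ℂ)) : Prop :=
  (∀ p ∈ Γ, p.1 ∈ sphere (0 : ℂ) 1) ∧
  ∀ l ∈ sphere (0 : ℂ) 1, ∃ c : ℝ → ℂ,
    IsSCC c ∧ (∀ t, c t ≠ 0) ∧ WindingOne c ∧ Set.range c = {w : ℂ | (l, w) ∈ Γ}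

/-- `g` is continuous on the closed unit disk and holomorphic on the open unit disk,
hence defines a holomorphic disk `{(λ, g λ) : λ ∈ Δ}`. -/
def HolDisk (g : ℂ → ℂ) : Prop :=
  ContinuousOn g (closedBall (0 : ℂ) 1) ∧ DifferentiableOn ℂ g (ball (0 : ℂ) 1)

/-- The trace `{(λ, g λ) : λ ∈ S¹}` of the disk defined by `g` lies in `Γ`. -/
def DiskTraceIn (g : ℂ → ℂ) (Γ : Set (ℂ × ℂ)) : Prop :=
  ∀ l ∈ sphere (0 : ℂ) 1, (l, g l) ∈ Γ

/-- The Wirtinger derivative `∂f/∂w = ½(∂f/∂x − i ∂f/∂y)` of `f : ℂ → ℝ`, as a complex number. -/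
def wirt (f : ℂ → ℝ) (w : ℂ) : ℂ :=
  (((fderiv ℝ f w 1 : ℝ) : ℂ) - Complex.I * ((fderiv ℝ f w Complex.I : ℝ) : ℂ)) / 2

/-- The torus `Γ^t = {(λ, w) : λ ∈ S¹, F(λ,w) = t}` cut out by the defining function `F`. -/
def TorusOf (F : ℂ → ℂ → ℝ) (t : ℝ) : Set (ℂ × ℂ) :=
  {p : ℂ × ℂ | p.1 ∈ sphere (0 : ℂ) 1 ∧ F p.1 p.2 = t}

/-- `F : S¹ × ℂ → ℝ` is a smooth defining function of a smooth family of graphical tori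
`Γ^t = F⁻¹(t)`, `t > 0`: each slice level set is a smooth simple closed curve of winding
number `1` around `0`, the level sets foliate `ℂ ∖ {0}` for each fixed `λ ∈ S¹`,
`F(λ,w) = |w|²` near `w = 0`, and `∂F/∂w ≠ 0` for `w ≠ 0`. -/
def IsSmoothTorusFamily (F : ℂ → ℂ → ℝ) : Prop :=
  ContDiffOn ℝ (⊤ : ℕ∞) (fun p : ℂ × ℂ => F p.1 p.2) (sphere (0 : ℂ) 1 ×ˢ univ) ∧
  (∀ l ∈ sphere (0 : ℂ) 1, ContDiff ℝ (⊤ : ℕ∞) (F l)) ∧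
  (∃ ε : ℝ, 0 < ε ∧ ∀ l ∈ sphere (0 : ℂ) 1, ∀ w : ℂ,
      Complex.normSq w < ε → F l w = Complex.normSq w) ∧
  (∀ l ∈ sphere (0 : ℂ) 1, ∀ w : ℂ, w ≠ 0 → 0 < F l w) ∧
  (∀ l ∈ sphere (0 : ℂ) 1, ∀ w : ℂ, w ≠ 0 → wirt (F l) w ≠ 0) ∧
  (∀ l ∈ sphere (0 : ℂ) 1, ∀ t : ℝ, 0 < t → ∃ c : ℝ → ℂ,
      IsSCC c ∧ (∀ s, c s ≠ 0) ∧ WindingOne c ∧ Set.range c = {w : ℂ | F l w = t})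

/-- A smooth function with values in prescribed convex sets that locally share a common point. -/
lemma exists_contDiff_mem_convex {t : ℝ → Set ℝ} (ht : ∀ x, Convex ℝ (t x))
    (hloc : ∀ x, ∃ c, ∀ᶠ y in nhds x, c ∈ t y) :
    ∃ k : ℝ → ℝ, ContDiff ℝ (⊤ : ℕ∞) k ∧ ∀ x, k x ∈ t x := by
  obtain ⟨g, hg⟩ := exists_contMDiffMap_forall_mem_convex_of_local_const
    (n := (⊤ : ℕ∞)) (modelWithCornersSelf ℝ ℝ) ht hloc
  exact ⟨g, g.contMDiff.contDiff, hg⟩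

lemma exists_smooth_antideriv {k : ℝ → ℝ} (hk : ContDiff ℝ (⊤ : ℕ∞) k) :
    ∃ K : ℝ → ℝ, ContDiff ℝ (⊤ : ℕ∞) K ∧ K 0 = 0 ∧ ∀ x, HasDerivAt K (k x) x := by
  have hd : ∀ x, HasDerivAt (fun x => ∫ s in (0 : ℝ)..x, k s) (k x) x := fun x =>
    intervalIntegral.integral_hasDerivAt_right (hk.continuous.intervalIntegrable _ _)
      hk.continuous.stronglyMeasurable.stronglyMeasurableAtFilter hk.continuous.continuousAt
  refine ⟨_, ?_, by simp, hd⟩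
  rw [contDiff_infty_iff_deriv]
  refine ⟨fun x => (hd x).differentiableAt, ?_⟩
  rwa [show deriv (fun x => ∫ s in (0 : ℝ)..x, k s) = k from funext fun x => (hd x).deriv]

lemma two_le_top : (2 : WithTop ℕ∞) ≤ ((⊤ : ℕ∞) : WithTop ℕ∞) := by
  exact WithTop.coe_le_coe.2 (le_top : (2 : ℕ∞) ≤ ⊤)

/-- The squared norm of the gradient of `f : ℂ → ℝ`. -/
def gradSq (f : ℂ → ℝ) (w : ℂ) : ℝ := fderiv ℝ f w 1 ^ 2 + fderiv ℝ f w Complex.I ^ 2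

lemma gradSq_nonneg (f : ℂ → ℝ) (w : ℂ) : 0 ≤ gradSq f w := by
  unfold gradSq; positivity

lemma gradSq_pos {f : ℂ → ℝ} {w : ℂ} (h : wirt f w ≠ 0) : 0 < gradSq f w := by
  refine (gradSq_nonneg f w).lt_of_ne fun h0 => h ?_
  have h1 : fderiv ℝ f w 1 = 0 := by
    unfold gradSq at h0; nlinarith [sq_nonneg (fderiv ℝ f w 1), sq_nonneg (fderiv ℝ f w Complex.I)]
  have h2 : fderiv ℝ f w Complex.I = 0 := by
    unfold gradSq at h0; nlinarith [sq_nonneg (fderiv ℝ f w 1), sq_nonneg (fderiv ℝ f w Complex.I)]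
  simp [wirt, h1, h2]

lemma lap_congr {f g : ℂ → ℝ} {w : ℂ} (h : f =ᶠ[nhds w] g) : lap f w = lap g w := by
  unfold lap; rw [h.iteratedFDeriv ℝ 2 |>.eq_of_nhds]

lemma gradSq_congr {f g : ℂ → ℝ} {w : ℂ} (h : f =ᶠ[nhds w] g) : gradSq f w = gradSq g w := by
  unfold gradSq; rw [h.fderiv_eq]

lemma lap_eq {f : ℂ → ℝ} {w : ℂ} (hf : ContDiffAt ℝ 2 f w) :
    lap f w = fderiv ℝ (fun z => fderiv ℝ f z 1) w 1 +
      fderiv ℝ (fun z => fderiv ℝ f z Complex.I) w Complex.I := by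
  have hd : DifferentiableAt ℝ (fderiv ℝ f) w :=
    (hf.fderiv_right (m := 1) (by norm_num)).differentiableAt (by norm_num)
  have h (v : ℂ) : fderiv ℝ (fun z => fderiv ℝ f z v) w v = fderiv ℝ (fderiv ℝ f) w v v := by
    rw [fderiv_clm_apply hd (differentiableAt_const v)]; simp
  simp [lap, iteratedFDeriv_two_apply, h]

lemma lap_add {f g : ℂ → ℝ} {w : ℂ} (hf : ContDiffAt ℝ 2 f w) (hg : ContDiffAt ℝ 2 g w) :
    lap (fun z => f z + g z) w = lap f w + lap g w := by
  unfold lap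
  rw [show (fun z => f z + g z) = f + g from rfl, iteratedFDeriv_add_apply hf hg]
  simp; ring

lemma lap_const_mul {g : ℂ → ℝ} {w : ℂ} (c : ℝ) (hg : ContDiffAt ℝ 2 g w) :
    lap (fun z => c * g z) w = c * lap g w := by
  unfold lap
  rw [show (fun z => c * g z) = c • g from rfl, iteratedFDeriv_const_smul_apply hg]
  simp; ring

lemma lap_comp {f : ℂ → ℝ} {w : ℂ} (hf : ContDiffAt ℝ 2 f w) {ρ g : ℝ → ℝ} {g' : ℝ}
    (hρ2 : ContDiffAt ℝ 2 ρ (f w))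
    (hρ : ∀ᶠ t in nhds (f w), HasDerivAt ρ (g t) t) (hg : HasDerivAt g g' (f w)) :
    lap (fun z => ρ (f z)) w = g' * gradSq f w + g (f w) * lap f w := by
  have hd : DifferentiableAt ℝ (fderiv ℝ f) w :=
    (hf.fderiv_right (m := 1) (by norm_num)).differentiableAt (by norm_num)
  have hev : ∀ᶠ z in nhds w, DifferentiableAt ℝ f z :=
    (hf.eventually (by norm_num)).mono fun z hz => hz.differentiableAt (by norm_num)
  have hev2 := hf.continuousAt.eventually hρ
  have h (v : ℂ) : fderiv ℝ (fun z => fderiv ℝ (fun z => ρ (f z)) z v) w v =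
      g' * fderiv ℝ f w v ^ 2 + g (f w) * fderiv ℝ (fun z => fderiv ℝ f z v) w v := by
    have e : (fun z => fderiv ℝ (fun z => ρ (f z)) z v) =ᶠ[nhds w]
        fun z => g (f z) * fderiv ℝ f z v := by
      filter_upwards [hev, hev2] with z h1 h2
      have h3 : fderiv ℝ (fun z => ρ (f z)) z = _ :=
        (h2.comp_hasFDerivAt z h1.hasFDerivAt).fderiv
      simp [h3]
    rw [e.fderiv_eq]
    have h1 := hg.comp_hasFDerivAt w (hf.differentiableAt (by norm_num)).hasFDerivAt
    have h2 : DifferentiableAt ℝ (fun z => fderiv ℝ f z v) w :=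
      hd.clm_apply (differentiableAt_const v)
    have h3 : fderiv ℝ (fun z => g (f z) * fderiv ℝ f z v) w = _ :=
      (h1.mul h2.hasFDerivAt).fderiv
    simp [h3]; ring
  have hc : ContDiffAt ℝ 2 (fun z => ρ (f z)) w := hρ2.comp w hf
  rw [lap_eq hc, lap_eq hf, h, h]; unfold gradSq; ring

lemma fderiv_normSq_apply (w v : ℂ) :
    fderiv ℝ (fun w : ℂ => Complex.normSq w) w v = 2 * (w.re * v.re + w.im * v.im) := by
  have h : HasFDerivAt (fun w : ℂ => w.re * w.re + w.im * w.im) _ w :=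
    (Complex.reCLM.hasFDerivAt.mul Complex.reCLM.hasFDerivAt).add
      (Complex.imCLM.hasFDerivAt.mul Complex.imCLM.hasFDerivAt)
  simp only [Complex.normSq_apply]
  rw [h.fderiv]; simp; ring

lemma contDiff_normSq : ContDiff ℝ (⊤ : ℕ∞) (fun w : ℂ => Complex.normSq w) := by
  simp only [Complex.normSq_apply]
  exact (Complex.reCLM.contDiff.mul Complex.reCLM.contDiff).add
    (Complex.imCLM.contDiff.mul Complex.imCLM.contDiff)

lemma gradSq_normSq (w : ℂ) :
    gradSq (fun w : ℂ => Complex.normSq w) w = 4 * Complex.normSq w := by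
  simp only [gradSq, fderiv_normSq_apply]
  simp [Complex.normSq_apply]; ring

lemma lap_normSq (w : ℂ) : lap (fun w : ℂ => Complex.normSq w) w = 4 := by
  rw [lap_eq (contDiff_normSq.contDiffAt.of_le two_le_top)]
  simp only [fderiv_normSq_apply]
  have h1 : fderiv ℝ (fun z : ℂ => 2 * (z.re * (1 : ℂ).re + z.im * (1 : ℂ).im)) w 1 = 2 := by
    have h : HasFDerivAt (fun z : ℂ => 2 * (z.re * (1 : ℂ).re + z.im * (1 : ℂ).im))
        ((2 : ℝ) • Complex.reCLM) w := by
      simpa using Complex.reCLM.hasFDerivAt.const_mul (2 : ℝ)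
    rw [h.fderiv]; simp
  have h2 : fderiv ℝ (fun z : ℂ => 2 * (z.re * Complex.I.re + z.im * Complex.I.im)) w
      Complex.I = 2 := by
    have h : HasFDerivAt (fun z : ℂ => 2 * (z.re * Complex.I.re + z.im * Complex.I.im))
        ((2 : ℝ) • Complex.imCLM) w := by
      simpa using Complex.imCLM.hasFDerivAt.const_mul (2 : ℝ)
    rw [h.fderiv]; simp
  rw [h1, h2]; norm_num

/-- Fibre derivatives of a function that is jointly smooth up to the boundary are jointly
smooth up to the boundary. -/
lemma contDiffOn_fderiv_fibre {U : Set ℂ} (hU : IsOpen U) {G : ℂ → ℂ → ℝ}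
    (hG : ContDiffOn ℝ (⊤ : ℕ∞) (fun p : ℂ × ℂ => G p.1 p.2) (closedBall (0 : ℂ) 1 ×ˢ U)) (v : ℂ) :
    ContDiffOn ℝ (⊤ : ℕ∞) (fun p : ℂ × ℂ => fderiv ℝ (G p.1) p.2 v)
      (closedBall (0 : ℂ) 1 ×ˢ U) := by
  have hS : UniqueDiffOn ℝ (closedBall (0 : ℂ) 1 ×ˢ U) :=
    (uniqueDiffOn_convex (convex_closedBall _ _)
      ⟨0, ball_subset_interior_closedBall (by simp)⟩).prod hU.uniqueDiffOn
  have h1 := (hG.fderivWithin hS (m := (⊤ : ℕ∞)) (by exact_mod_cast le_top)).clm_apply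
    (contDiffOn_const (c := ((0 : ℂ), v)))
  refine h1.congr ?_
  rintro ⟨l, w⟩ ⟨hl, hw⟩
  have h2 := (hG.differentiableOn (by simp) (l, w) ⟨hl, hw⟩).hasFDerivWithinAt
  have h3 : HasFDerivWithinAt (fun z : ℂ => (l, z)) (ContinuousLinearMap.inr ℝ ℂ ℂ) U w :=
    (hasFDerivAt_prodMk_right l w).hasFDerivWithinAt
  have h4 := (h2.comp w h3 fun z hz => ⟨hl, hz⟩).hasFDerivAt (hU.mem_nhds hw)
  have h5 : fderiv ℝ (G l) w = _ := h4.fderiv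
  simp [h5]

lemma contDiffAt_fibre {U : Set ℂ} (hU : IsOpen U) {G : ℂ → ℂ → ℝ}
    (hG : ContDiffOn ℝ (⊤ : ℕ∞) (fun p : ℂ × ℂ => G p.1 p.2) (closedBall (0 : ℂ) 1 ×ˢ U))
    {l w : ℂ} (hl : l ∈ closedBall (0 : ℂ) 1) (hw : w ∈ U) : ContDiffAt ℝ 2 (G l) w := by
  have h : ContDiffOn ℝ (⊤ : ℕ∞) (G l) U :=
    hG.comp (f := fun z : ℂ => (l, z)) (contDiff_prodMk_right l).contDiffOn
      fun z hz => ⟨hl, hz⟩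
  exact (h.contDiffAt (hU.mem_nhds hw)).of_le two_le_top

lemma continuousOn_lap_fibre {U : Set ℂ} (hU : IsOpen U) {G : ℂ → ℂ → ℝ}
    (hG : ContDiffOn ℝ (⊤ : ℕ∞) (fun p : ℂ × ℂ => G p.1 p.2) (closedBall (0 : ℂ) 1 ×ˢ U)) :
    ContinuousOn (fun p : ℂ × ℂ => lap (G p.1) p.2) (closedBall (0 : ℂ) 1 ×ˢ U) := by
  have h1 := contDiffOn_fderiv_fibre hU
    (G := fun l w => fderiv ℝ (G l) w 1) (contDiffOn_fderiv_fibre hU hG 1) 1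
  have h2 := contDiffOn_fderiv_fibre hU
    (G := fun l w => fderiv ℝ (G l) w Complex.I) (contDiffOn_fderiv_fibre hU hG Complex.I) Complex.I
  exact (h1.continuousOn.add h2.continuousOn).congr fun p hp =>
    lap_eq (contDiffAt_fibre hU hG hp.1 hp.2)

lemma continuousOn_gradSq_fibre {U : Set ℂ} (hU : IsOpen U) {G : ℂ → ℂ → ℝ}
    (hG : ContDiffOn ℝ (⊤ : ℕ∞) (fun p : ℂ × ℂ => G p.1 p.2) (closedBall (0 : ℂ) 1 ×ˢ U)) :
    ContinuousOn (fun p : ℂ × ℂ => gradSq (G p.1) p.2) (closedBall (0 : ℂ) 1 ×ˢ U) :=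
  ((contDiffOn_fderiv_fibre hU hG 1).continuousOn.pow 2).add
    ((contDiffOn_fderiv_fibre hU hG Complex.I).continuousOn.pow 2)

/-- A continuous function on `Δ̄ × (ℂ ∖ {0})` which is positive over `∂Δ` and near `w = 0` becomes
positive after adding `(1 - |λ|²) κ(|w|²)` for a suitable smooth `κ ≥ 0` vanishing near `0`. -/
lemma exists_positive_correction {A : ℂ → ℂ → ℝ}
    (hA : ContinuousOn (fun p : ℂ × ℂ => A p.1 p.2) (closedBall (0 : ℂ) 1 ×ˢ {w : ℂ | w ≠ 0}))
    {a : ℝ} (ha : 0 < a) (hb : ∀ l ∈ sphere (0 : ℂ) 1, ∀ w : ℂ, w ≠ 0 → 0 < A l w)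
    (hs : ∀ l ∈ closedBall (0 : ℂ) 1, ∀ w : ℂ, w ≠ 0 → Complex.normSq w < a → 0 < A l w) :
    ∃ κ : ℝ → ℝ, ContDiff ℝ (⊤ : ℕ∞) κ ∧ (∀ s, 0 ≤ κ s) ∧ (∀ s < a / 2, κ s = 0) ∧
      ∀ l ∈ closedBall (0 : ℂ) 1, ∀ w : ℂ, w ≠ 0 →
        0 < A l w + (1 - Complex.normSq l) * κ (Complex.normSq w) := by
  have hl1 (l : ℂ) (hl : l ∈ closedBall (0 : ℂ) 1) : 0 ≤ 1 - Complex.normSq l := by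
    rw [Complex.normSq_eq_norm_sq]
    have : ‖l‖ ≤ 1 := by simpa using hl
    nlinarith [norm_nonneg l]
  let t : ℝ → Set ℝ := fun s => {y | 0 ≤ y ∧ (s < a / 2 → y = 0) ∧ ∀ l ∈ closedBall (0 : ℂ) 1,
    ∀ w : ℂ, w ≠ 0 → Complex.normSq w = s → 0 < A l w + (1 - Complex.normSq l) * y}
  suffices h : ∃ κ : ℝ → ℝ, ContDiff ℝ (⊤ : ℕ∞) κ ∧ ∀ s, κ s ∈ t s by
    obtain ⟨κ, hκ, h⟩ := h
    exact ⟨κ, hκ, fun s => (h s).1, fun s => (h s).2.1,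
      fun l hl w hw => (h (Complex.normSq w)).2.2 l hl w hw rfl⟩
  refine exists_contDiff_mem_convex ?_ ?_
  · intro s x hx y hy p q hp hq hpq
    simp only [smul_eq_mul]
    refine ⟨add_nonneg (mul_nonneg hp hx.1) (mul_nonneg hq hy.1), fun h => ?_, fun l hl w hw e => ?_⟩
    · simp [hx.2.1 h, hy.2.1 h]
    · have h1 := hx.2.2 l hl w hw e
      have h2 := hy.2.2 l hl w hw e
      have := (convex_Ioi (0 : ℝ)) h1 h2 hp hq hpq
      simp only [smul_eq_mul, mem_Ioi] at this
      have e2 : A l w = (p + q) * A l w := by rw [hpq, one_mul]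
      rw [e2]; linarith
  · intro s
    rcases lt_or_ge s a with hsa | hsa
    · refine ⟨0, ?_⟩
      filter_upwards [Iio_mem_nhds hsa] with y hy
      refine ⟨le_rfl, fun _ => rfl, fun l hl w hw e => ?_⟩
      simpa using hs l hl w hw (e ▸ hy)
    · set K : Set (ℂ × ℂ) :=
        closedBall (0 : ℂ) 1 ×ˢ {w : ℂ | a / 2 ≤ Complex.normSq w ∧ Complex.normSq w ≤ s + 1}
      have hKc : IsCompact K := by
        refine (isCompact_closedBall _ _).prod (Metric.isCompact_of_isClosed_isBounded ?_ ?_)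
        · exact (isClosed_le continuous_const Complex.continuous_normSq).inter
            (isClosed_le Complex.continuous_normSq continuous_const)
        · refine Metric.isBounded_closedBall (x := (0 : ℂ)) (r := Real.sqrt (s + 1)) |>.subset ?_
          rintro w ⟨-, hw⟩
          rw [Complex.normSq_eq_norm_sq] at hw
          simpa using Real.le_sqrt_of_sq_le hw
      have hKs : K ⊆ closedBall (0 : ℂ) 1 ×ˢ {w : ℂ | w ≠ 0} := by
        rintro ⟨l, w⟩ ⟨hl, hw, -⟩
        refine ⟨hl, ?_⟩
        rintro rfl
        simp at hw; linarith
      have hAK := hA.mono hKs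
      set Z : Set (ℂ × ℂ) := K ∩ (fun p : ℂ × ℂ => A p.1 p.2) ⁻¹' Iic 0
      have hZ : IsCompact Z :=
        hKc.of_isClosed_subset (hAK.preimage_isClosed_of_isClosed hKc.isClosed isClosed_Iic)
          inter_subset_left
      have hZpos : ∀ p ∈ Z, 0 < 1 - Complex.normSq p.1 := by
        rintro ⟨l, w⟩ ⟨hp, hp'⟩
        refine (hl1 l hp.1).lt_of_ne fun h0 => ?_
        have hl : l ∈ sphere (0 : ℂ) 1 := by
          have h1 : 1 - Complex.normSq l = 0 := h0.symm
          have : ‖l‖ ^ 2 = 1 := by rw [← Complex.normSq_eq_norm_sq]; linarith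
          simpa using (pow_eq_one_iff_of_nonneg (norm_nonneg l) two_ne_zero).1 this
        have := hb l hl w (hKs hp).2
        simp only [mem_preimage, mem_Iic] at hp'
        linarith
      obtain ⟨C, hC⟩ := hZ.exists_bound_of_continuousOn
        (f := fun p : ℂ × ℂ => A p.1 p.2 / (1 - Complex.normSq p.1))
        ((hAK.mono inter_subset_left).div
          (continuous_const.sub (Complex.continuous_normSq.comp continuous_fst)).continuousOn
          fun p hp => (hZpos p hp).ne')
      refine ⟨|C| + 1, ?_⟩
      filter_upwards [Ioo_mem_nhds (show a / 2 < s by linarith) (lt_add_one s)] with y hy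
      refine ⟨by positivity, fun h => absurd hy.1 h.not_gt, fun l hl w hw e => ?_⟩
      have hp : (l, w) ∈ K := ⟨hl, by rw [Set.mem_ofPred, e]; exact ⟨hy.1.le, hy.2.le⟩⟩
      by_cases hn : A l w ≤ 0
      · have h1 := hZpos (l, w) ⟨hp, hn⟩
        have h2 := (abs_le.1 (hC (l, w) ⟨hp, hn⟩)).1
        simp only at h1 h2
        rw [le_div_iff₀ h1] at h2
        nlinarith [le_abs_self C]
      · have := mul_nonneg (hl1 l hl) (show (0 : ℝ) ≤ |C| + 1 by positivity)
        linarith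

lemma IsSmoothTorusFamily.apply_zero {F : ℂ → ℂ → ℝ} (hF : IsSmoothTorusFamily F) {l : ℂ}
    (hl : l ∈ sphere (0 : ℂ) 1) : F l 0 = 0 := by
  obtain ⟨ε, hε, h⟩ := hF.2.2.1
  simpa using h l hl 0 (by simpa using hε)

/-- If `F l > T` on the circle of radius `R`, the sublevel set `{F l ≤ T}` lies inside it. -/
lemma IsSmoothTorusFamily.norm_lt {F : ℂ → ℂ → ℝ} (hF : IsSmoothTorusFamily F) {l : ℂ}
    (hl : l ∈ sphere (0 : ℂ) 1) {R T : ℝ} (hR : 0 < R) (h : ∀ z : ℂ, ‖z‖ = R → T < F l z)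
    {w : ℂ} (hw : F l w ≤ T) : ‖w‖ < R := by
  rcases eq_or_ne w 0 with rfl | hw0
  · simpa using hR
  obtain ⟨c, hc, -, -, hcr⟩ := hF.2.2.2.2.2 l hl (F l w) (hF.2.2.2.1 l hl w hw0)
  have hpre : IsPreconnected {z : ℂ | F l z = F l w} := by
    rw [← hcr]; exact isPreconnected_range hc.1.continuous
  have hcont : Continuous fun r : ℝ => F l (r : ℂ) :=
    (hF.2.1 l hl).continuous.comp Complex.continuous_ofReal
  obtain ⟨r, hr, hrw⟩ : F l w ∈ (fun r : ℝ => F l (r : ℂ)) '' Icc 0 R := by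
    refine intermediate_value_Icc hR.le hcont.continuousOn ⟨?_, ?_⟩
    · simpa [hF.apply_zero hl] using (hF.2.2.2.1 l hl w hw0).le
    · exact (hw.trans_lt (h _ (by simp [abs_of_pos hR]))).le
  by_contra hcon
  obtain ⟨z, hz, hzR⟩ := hpre.intermediate_value (f := fun z : ℂ => ‖z‖) (a := (r : ℂ)) (b := w)
    hrw rfl continuous_norm.continuousOn
    (show R ∈ Icc ‖(r : ℂ)‖ ‖w‖ from ⟨by simpa [abs_of_nonneg hr.1] using hr.2, not_lt.1 hcon⟩)
  have h1 := h z hzR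
  have h2 : F l z = F l w := hz
  linarith

/-- Each fibre of a smooth torus family is large on all large circles. -/
lemma IsSmoothTorusFamily.exists_radius {F : ℂ → ℂ → ℝ} (hF : IsSmoothTorusFamily F) {l : ℂ}
    (hl : l ∈ sphere (0 : ℂ) 1) (T : ℝ) : ∃ R : ℝ, 0 < R ∧ ∀ z : ℂ, ‖z‖ = R → T < F l z := by
  have hcont := (hF.2.1 l hl).continuous
  have hlev (t : ℝ) (ht : 0 < t) : ∃ z, F l z = t ∧ Bornology.IsBounded {w : ℂ | F l w = t} := by
    obtain ⟨c, hc, -, -, hcr⟩ := hF.2.2.2.2.2 l hl t ht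
    refine ⟨c 0, by have : c 0 ∈ range c := mem_range_self 0
                    rwa [hcr] at this, ?_⟩
    rw [← hcr]
    exact (Function.Periodic.compact_of_continuous hc.2.1 (by positivity)
      hc.1.continuous).isBounded
  obtain ⟨-, -, hbd⟩ := hlev (|T| + 1) (by positivity)
  obtain ⟨R, hR, hRb⟩ := hbd.exists_pos_norm_lt
  have hE : IsPreconnected {z : ℂ | R ≤ ‖z‖} := by
    have h1 : IsPreconnected ((fun p : ℝ × ℂ => (p.1 : ℂ) * p.2) '' (Ici R ×ˢ sphere (0 : ℂ) 1)) :=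
      (isPreconnected_Ici.prod (isPreconnected_sphere (by simp) 0 1)).image _ (by fun_prop)
    convert h1 using 1
    ext z
    constructor
    · intro hz
      have hz0 : ‖z‖ ≠ 0 := (hR.trans_le hz).ne'
      refine ⟨(‖z‖, z / ‖z‖), ⟨hz, by simp [hz0]⟩, ?_⟩
      have : (‖z‖ : ℂ) ≠ 0 := by exact_mod_cast hz0
      simp only; field_simp
    · rintro ⟨⟨r, u⟩, ⟨hr, hu⟩, rfl⟩
      have hu1 : ‖u‖ = 1 := by simpa using hu
      simpa [hu1] using le_trans hr (le_abs_self r)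
  refine ⟨R, hR, fun z hz => ?_⟩
  by_contra hcon
  obtain ⟨M, hM⟩ := (isCompact_closedBall (0 : ℂ) R).exists_bound_of_continuousOn
    hcont.continuousOn
  obtain ⟨y, hy, -⟩ := hlev (|M| + |T| + 2) (by positivity)
  have hyR : R ≤ ‖y‖ := by
    by_contra hlt
    have := (abs_le.1 (hM y (by simpa using (not_le.1 hlt).le))).2
    linarith [le_abs_self M, abs_nonneg T]
  obtain ⟨x, hx, hxT⟩ := hE.intermediate_value (a := z) (b := y) (show R ≤ ‖z‖ from hz.ge) hyR
    hcont.continuousOn (show |T| + 1 ∈ Icc (F l z) (F l y) from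
      ⟨by linarith [le_abs_self T], by rw [hy]; linarith [abs_nonneg M]⟩)
  exact absurd (hRb x hxT) (not_lt.2 hx)

/-- Sublevel sets of a smooth torus family are bounded uniformly over the circle. -/
lemma IsSmoothTorusFamily.exists_bound {F : ℂ → ℂ → ℝ} (hF : IsSmoothTorusFamily F) (T : ℝ) :
    ∃ R : ℝ, ∀ l ∈ sphere (0 : ℂ) 1, ∀ w : ℂ, F l w ≤ T → ‖w‖ ≤ R := by
  have hcont : Continuous fun p : sphere (0 : ℂ) 1 × ℂ => F p.1 p.2 :=
    hF.1.continuousOn.comp_continuous (f := fun p : sphere (0 : ℂ) 1 × ℂ => ((p.1 : ℂ), p.2))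
      (by fun_prop) fun p => ⟨p.1.2, mem_univ _⟩
  have key : ∃ R : ℝ, ∀ l ∈ (univ : Set (sphere (0 : ℂ) 1)), ∀ w : ℂ, F (l : ℂ) w ≤ T → ‖w‖ ≤ R := by
    refine (isCompact_univ (X := sphere (0 : ℂ) 1)).induction_on
      (p := fun s => ∃ R : ℝ, ∀ l ∈ s, ∀ w : ℂ, F (l : ℂ) w ≤ T → ‖w‖ ≤ R) ?_ ?_ ?_ ?_
    · exact ⟨0, by simp⟩
    · rintro s t hst ⟨R, hR⟩
      exact ⟨R, fun l hl => hR l (hst hl)⟩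
    · rintro s t ⟨R, hR⟩ ⟨R', hR'⟩
      refine ⟨max R R', fun l hl w hw => ?_⟩
      rcases hl with hl | hl
      · exact (hR l hl w hw).trans (le_max_left _ _)
      · exact (hR' l hl w hw).trans (le_max_right _ _)
    · rintro l -
      obtain ⟨R, hR, h⟩ := hF.exists_radius l.2 T
      have hev := (isCompact_sphere (0 : ℂ) R).eventually_forall_of_forall_eventually (x₀ := l)
        (P := fun l z => T < F l z) fun z hz =>
          hcont.continuousAt.eventually (lt_mem_nhds (h z (by simpa using hz)))
      rw [nhdsWithin_univ]
      exact ⟨_, hev, R, fun l' hl' w hw =>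
        (hF.norm_lt l'.2 hR (fun z hz => hl' z (by simpa using hz)) hw).le⟩
  obtain ⟨R, hR⟩ := key
  exact ⟨R, fun l hl => hR ⟨l, hl⟩ (mem_univ _)⟩

/-- The coefficient `k` controlling the concavity of the reparametrization. -/
lemma IsSmoothTorusFamily.exists_ratio_bound {F : ℂ → ℂ → ℝ} (hF : IsSmoothTorusFamily F)
    (hFs : ContDiffOn ℝ (⊤ : ℕ∞) (fun p : ℂ × ℂ => F p.1 p.2)
      (closedBall (0 : ℂ) 1 ×ˢ univ))
    {ε : ℝ} (hε : 0 < ε)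
    (hFnear : ∀ l ∈ closedBall (0 : ℂ) 1, ∀ w : ℂ, ‖w‖ ≤ ε → F l w = Complex.normSq w) :
    ∃ k : ℝ → ℝ, ContDiff ℝ (⊤ : ℕ∞) k ∧ (∀ t, 0 ≤ k t) ∧
      ∀ l ∈ sphere (0 : ℂ) 1, ∀ w : ℂ, w ≠ 0 →
        lap (F l) w < (1 / F l w + 1 + k (F l w)) * gradSq (F l) w := by
  have hgrad (l : ℂ) (hl : l ∈ sphere (0 : ℂ) 1) (w : ℂ) (hw : w ≠ 0) : 0 < gradSq (F l) w :=
    gradSq_pos (hF.2.2.2.2.1 l hl w hw)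
  let s : ℝ → Set ℝ := fun t => {y | 0 ≤ y ∧ ∀ l ∈ sphere (0 : ℂ) 1, ∀ w : ℂ, w ≠ 0 → F l w = t →
    lap (F l) w < (1 / t + 1 + y) * gradSq (F l) w}
  suffices h : ∃ k : ℝ → ℝ, ContDiff ℝ (⊤ : ℕ∞) k ∧ ∀ t, k t ∈ s t by
    obtain ⟨k, hk, h⟩ := h
    exact ⟨k, hk, fun t => (h t).1, fun l hl w hw => (h (F l w)).2 l hl w hw rfl⟩
  refine exists_contDiff_mem_convex ?_ ?_
  · intro t x hx y hy p q hp hq hpq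
    simp only [smul_eq_mul]
    refine ⟨add_nonneg (mul_nonneg hp hx.1) (mul_nonneg hq hy.1), fun l hl w hw e => ?_⟩
    have h1 := sub_pos.2 (hx.2 l hl w hw e)
    have h2 := sub_pos.2 (hy.2 l hl w hw e)
    have h3 := (convex_Ioi (0 : ℝ)) h1 h2 hp hq hpq
    simp only [smul_eq_mul, mem_Ioi] at h3
    obtain rfl : q = 1 - p := by linarith
    linarith
  · intro t
    rcases lt_or_ge t (ε ^ 2) with ht | ht
    · refine ⟨0, ?_⟩
      filter_upwards [Iio_mem_nhds ht] with y hy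
      refine ⟨le_rfl, fun l hl w hw e => ?_⟩
      have hlc := sphere_subset_closedBall hl
      have hwε : ‖w‖ < ε := hF.norm_lt hl hε (T := y) (fun z hz => by
        rw [hFnear l hlc z hz.le, Complex.normSq_eq_norm_sq, hz]; exact hy) e.le
      have hev : F l =ᶠ[nhds w] fun z => Complex.normSq z := by
        filter_upwards [(continuous_norm.tendsto w).eventually (gt_mem_nhds hwε)] with z hz
        exact hFnear l hlc z hz.le
      have hpos : 0 < Complex.normSq w := Complex.normSq_pos.2 hw
      rw [lap_congr hev, gradSq_congr hev, lap_normSq, gradSq_normSq, ← e,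
        show F l w = Complex.normSq w from hev.eq_of_nhds]
      field_simp
      linarith
    · obtain ⟨R, hR⟩ := hF.exists_bound (t + 1)
      have hcont : ContinuousOn (fun p : ℂ × ℂ => F p.1 p.2)
          (sphere (0 : ℂ) 1 ×ˢ closedBall (0 : ℂ) R) :=
        hF.1.continuousOn.mono (prod_mono_right (subset_univ _))
      set K : Set (ℂ × ℂ) := (sphere (0 : ℂ) 1 ×ˢ closedBall (0 : ℂ) R) ∩
        (fun p : ℂ × ℂ => F p.1 p.2) ⁻¹' Icc (ε ^ 2 / 2) (t + 1)
      have hSc : IsCompact (sphere (0 : ℂ) 1 ×ˢ closedBall (0 : ℂ) R) :=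
        (isCompact_sphere _ _).prod (isCompact_closedBall _ _)
      have hK : IsCompact K := hSc.of_isClosed_subset
        (hcont.preimage_isClosed_of_isClosed hSc.isClosed isClosed_Icc) inter_subset_left
      have hKs : K ⊆ closedBall (0 : ℂ) 1 ×ˢ univ := fun p hp =>
        ⟨sphere_subset_closedBall hp.1.1, mem_univ _⟩
      have hK0 : ∀ p ∈ K, 0 < gradSq (F p.1) p.2 := by
        rintro ⟨l, w⟩ ⟨⟨hl, -⟩, h1, -⟩
        refine hgrad l hl w ?_
        rintro rfl
        simp only [hF.apply_zero hl] at h1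
        nlinarith [pow_pos hε 2]
      obtain ⟨C, hC⟩ := hK.exists_bound_of_continuousOn
        (f := fun p : ℂ × ℂ => lap (F p.1) p.2 / gradSq (F p.1) p.2)
        (((continuousOn_lap_fibre isOpen_univ hFs).mono hKs).div
          ((continuousOn_gradSq_fibre isOpen_univ hFs).mono hKs) fun p hp => (hK0 p hp).ne')
      refine ⟨|C|, ?_⟩
      have hε2 : 0 < ε ^ 2 := pow_pos hε 2
      filter_upwards [Ioo_mem_nhds (show ε ^ 2 / 2 < t by linarith) (lt_add_one t)] with y hy
      refine ⟨abs_nonneg _, fun l hl w hw e => ?_⟩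
      have hp : (l, w) ∈ K := by
        refine ⟨⟨hl, ?_⟩, ?_⟩
        · simpa using hR l hl w (e.trans_le hy.2.le)
        · show F l w ∈ Icc (ε ^ 2 / 2) (t + 1)
          rw [e]; exact ⟨hy.1.le, hy.2.le⟩
      have hg := hgrad l hl w hw
      have h2 := (abs_le.1 (hC (l, w) hp)).2
      rw [div_le_iff₀ hg] at h2
      have hy0 : 0 < 1 / y := one_div_pos.2 (by linarith [hy.1])
      refine h2.trans_lt (mul_lt_mul_of_pos_right ?_ hg)
      linarith [le_abs_self C]

/-- A smooth concave-in-`log t` reparametrization `t ↦ 1 + P (log t)`, given by the derivative `p`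
of `P`, with logarithmic derivative of its `t`-derivative equal to `-(1 / t + 1 + k t)`. -/
lemma exists_reparametrization {k : ℝ → ℝ} (hk : ContDiff ℝ (⊤ : ℕ∞) k) (hk0 : ∀ t, 0 ≤ k t) :
    ∃ P p : ℝ → ℝ, ContDiff ℝ (⊤ : ℕ∞) P ∧ P 0 = 0 ∧ StrictMono P ∧
      Filter.Tendsto P Filter.atBot Filter.atBot ∧ (∀ x, 0 < p x) ∧
      (∀ x, HasDerivAt P (p x) x) ∧
      ∀ t, 0 < t → HasDerivAt (fun s => p (Real.log s) / s)
        (-(1 / t + 1 + k t) * (p (Real.log t) / t)) t := by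
  obtain ⟨K, hK, -, hKd⟩ := exists_smooth_antideriv hk
  set p : ℝ → ℝ := fun x => Real.exp (-(Real.exp x + K (Real.exp x))) with hp
  have hpc : ContDiff ℝ (⊤ : ℕ∞) p :=
    Real.contDiff_exp.comp (Real.contDiff_exp.add (hK.comp Real.contDiff_exp)).neg
  obtain ⟨P, hP, hP0, hPd⟩ := exists_smooth_antideriv hpc
  have hppos (x : ℝ) : 0 < p x := Real.exp_pos _
  have hKmono : Monotone K := monotone_of_deriv_nonneg (fun x => (hKd x).differentiableAt)
    fun x => by rw [(hKd x).deriv]; exact hk0 x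
  have hpanti : Antitone p := fun x y hxy => by
    have h1 := Real.exp_le_exp.2 hxy
    exact Real.exp_le_exp.2 (neg_le_neg (add_le_add h1 (hKmono h1)))
  refine ⟨P, p, hP, hP0, strictMono_of_deriv_pos fun x => by rw [(hPd x).deriv]; exact hppos x,
    ?_, hppos, hPd, fun t ht => ?_⟩
  · have hle : ∀ x ≤ 0, P x ≤ p 0 * x := by
      intro x hx
      have hd (y : ℝ) : HasDerivAt (fun y => P y - p 0 * y) (p y - p 0) y := by
        have h := (hPd y).sub ((hasDerivAt_id y).const_mul (p 0))
        rw [mul_one] at h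
        exact h
      have hm : MonotoneOn (fun y => P y - p 0 * y) (Iic 0) := by
        refine monotoneOn_of_deriv_nonneg (convex_Iic 0)
          (fun y _ => (hd y).continuousAt.continuousWithinAt)
          (fun y _ => (hd y).differentiableAt.differentiableWithinAt) fun y hy => ?_
        rw [(hd y).deriv]
        have hy0 : y ∈ Iic (0 : ℝ) := interior_subset hy
        exact sub_nonneg.2 (hpanti hy0)
      have := hm hx (mem_Iic.2 le_rfl) hx
      simp only [hP0] at this
      linarith
    refine Filter.tendsto_atBot_mono' _ ?_ (Filter.tendsto_id.const_mul_atBot (hppos 0))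
    filter_upwards [Filter.eventually_le_atBot 0] with x hx using hle x hx
  · have hev : (fun s => Real.exp (-(s + K s)) / s) =ᶠ[nhds t] fun s => p (Real.log s) / s := by
      filter_upwards [lt_mem_nhds ht] with s hs
      simp only [hp, Real.exp_log hs]
    have h1 : HasDerivAt (fun s => Real.exp (-(s + K s)) / s)
        ((Real.exp (-(t + K t)) * -(1 + k t) * t - Real.exp (-(t + K t)) * 1) / t ^ 2) t :=
      ((hasDerivAt_id t).add (hKd t)).neg.exp.div (hasDerivAt_id t) ht.ne'
    refine (h1.congr_of_eventuallyEq hev.symm).congr_deriv ?_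
    simp only [hp, Real.exp_log ht]
    field_simp
    ring

/-- A smooth radial function `U(|w|²)` with Laplacian at most `-κ(|w|²)`. -/
lemma exists_radial {κ : ℝ → ℝ} (hκ : ContDiff ℝ (⊤ : ℕ∞) κ) (hκ0 : ∀ s, 0 ≤ κ s) {a : ℝ}
    (ha : 0 < a) (hκa : ∀ s < a, κ s = 0) :
    ∃ U : ℝ → ℝ, ContDiff ℝ (⊤ : ℕ∞) U ∧ (∀ s, 0 ≤ s → U s ≤ 0) ∧
      ∀ w : ℂ, lap (fun z => U (Complex.normSq z)) w ≤ -κ (Complex.normSq w) := by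
  obtain ⟨M, hM, hM0, hMd⟩ := exists_smooth_antideriv
    (k := fun s => κ s / (4 * a)) (hκ.div_const _)
  obtain ⟨V, hV, hV0, hVd⟩ := exists_smooth_antideriv hM
  have hMmono : Monotone M := monotone_of_deriv_nonneg (fun x => (hMd x).differentiableAt)
    fun x => by rw [(hMd x).deriv]; exact div_nonneg (hκ0 x) (by positivity)
  have hMnn (s : ℝ) (hs : 0 ≤ s) : 0 ≤ M s := hM0 ▸ hMmono hs
  refine ⟨fun s => -V s, hV.neg, fun s hs => ?_, fun w => ?_⟩
  · have : MonotoneOn V (Ici 0) := monotoneOn_of_deriv_nonneg (convex_Ici 0)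
      hV.continuous.continuousOn (fun y _ => (hVd y).differentiableAt.differentiableWithinAt)
      fun y hy => by
        rw [(hVd y).deriv]
        exact hMnn y (mem_Ici.1 (interior_subset hy))
    have := this (mem_Ici.2 le_rfl) hs hs
    rw [hV0] at this
    linarith
  · rw [lap_comp (f := fun z => Complex.normSq z) (ρ := fun s => -V s)
      (contDiff_normSq.contDiffAt.of_le two_le_top) (hV.neg.contDiffAt.of_le two_le_top)
      (Filter.Eventually.of_forall fun t => (hVd t).neg) (hMd _).neg, gradSq_normSq, lap_normSq]
    set s := Complex.normSq w
    have hs : 0 ≤ s := Complex.normSq_nonneg w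
    have h1 := hMnn s hs
    have h2 : κ s ≤ κ s / (4 * a) * (4 * s) := by
      rcases lt_or_ge s a with h | h
      · simp [hκa s h]
      · rw [div_mul_eq_mul_div, le_div_iff₀ (by positivity)]
        nlinarith [hκ0 s]
    linarith

/-- **Existence of a fiberwise superharmonic defining function `ψ`.** Given a smooth family
of graphical tori with defining function `F`, extended smoothly to `Δ̄ × ℂ` with
`F(λ,w) = |w|²` for `‖w‖ ≤ ε` and `∂F/∂w ≠ 0` for `w ≠ 0`, there is a
`ψ : Δ̄ × ℂ → ℝ ∪ {−∞}`, smooth away from `{w = 0}`, with `Δ_w ψ < 0`, whose restriction to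
`S¹ × (ℂ ∖ {0})` defines the foliation by the tori `Γ^t` (a strictly increasing
reparametrization of `F`), with `ψ(λ,0) = −∞` (i.e. `ψ(λ,w) → −∞` as `w → 0`), and with
`ψ_λ⁻¹(1) = C_λ = C¹_λ` for `|λ| = 1`. -/
theorem exists_superharmonic_defining_function (F : ℂ → ℂ → ℝ)
    (hF : IsSmoothTorusFamily F)
    (hFs : ContDiffOn ℝ (⊤ : ℕ∞) (fun p : ℂ × ℂ => F p.1 p.2)
      (closedBall (0 : ℂ) 1 ×ˢ univ))
    (ε : ℝ) (hε : 0 < ε)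
    (hFnear : ∀ l ∈ closedBall (0 : ℂ) 1, ∀ w : ℂ, ‖w‖ ≤ ε → F l w = Complex.normSq w)
    (hFw : ∀ l ∈ closedBall (0 : ℂ) 1, ∀ w : ℂ, w ≠ 0 → wirt (F l) w ≠ 0) :
    ∃ ψ : ℂ → ℂ → ℝ,
      ContDiffOn ℝ (⊤ : ℕ∞) (fun p : ℂ × ℂ => ψ p.1 p.2)
        (closedBall (0 : ℂ) 1 ×ˢ {w : ℂ | w ≠ 0}) ∧
      (∀ l ∈ closedBall (0 : ℂ) 1, ∀ w : ℂ, w ≠ 0 → lap (ψ l) w < 0) ∧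
      (∀ l ∈ closedBall (0 : ℂ) 1,
        Filter.Tendsto (ψ l) (nhdsWithin 0 {w : ℂ | w ≠ 0}) Filter.atBot) ∧
      (∃ ρ : ℝ → ℝ, StrictMonoOn ρ (Ioi 0) ∧ ρ 1 = 1 ∧
        ∀ l ∈ sphere (0 : ℂ) 1, ∀ w : ℂ, w ≠ 0 → ψ l w = ρ (F l w)) ∧
      (∀ l ∈ sphere (0 : ℂ) 1, ∀ w : ℂ, w ≠ 0 → (ψ l w = 1 ↔ F l w = 1)) := by
  obtain ⟨k, hk, hk0, hklt⟩ := hF.exists_ratio_bound hFs hε hFnear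
  obtain ⟨P, p, hP, hP0, hPmono, hPbot, hp0, hPd, hpd⟩ := exists_reparametrization hk hk0
  have hε2 : 0 < ε ^ 2 := pow_pos hε 2
  have hUo : IsOpen {w : ℂ | w ≠ 0} := isOpen_ne
  have hFs' := hFs.mono (prod_mono_right (t₁ := {w : ℂ | w ≠ 0}) (subset_univ _))
  have hsmall (l : ℂ) (hl : l ∈ closedBall (0 : ℂ) 1) (w : ℂ) (hw : Complex.normSq w < ε ^ 2) :
      F l w = Complex.normSq w := by
    rw [Complex.normSq_eq_norm_sq] at hw
    exact hFnear l hl w (lt_of_pow_lt_pow_left₀ 2 hε.le hw).le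
  -- Correct `F` over the interior of the disk so that it becomes positive.
  obtain ⟨κ, hκ, -, hκa, hκpos⟩ := exists_positive_correction hFs'.continuousOn hε2
    hF.2.2.2.1 fun l hl w hw h => by rw [hsmall l hl w h]; exact Complex.normSq_pos.2 hw
  let G : ℂ → ℂ → ℝ := fun l w => F l w + (1 - Complex.normSq l) * κ (Complex.normSq w)
  have hradial {u : ℝ → ℝ} (hu : ContDiff ℝ (⊤ : ℕ∞) u) : ContDiff ℝ (⊤ : ℕ∞)
      (fun q : ℂ × ℂ => (1 - Complex.normSq q.1) * u (Complex.normSq q.2)) :=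
    (contDiff_const.sub (contDiff_normSq.comp contDiff_fst)).mul
      (hu.comp (contDiff_normSq.comp contDiff_snd))
  have hGs : ContDiffOn ℝ (⊤ : ℕ∞) (fun q : ℂ × ℂ => G q.1 q.2)
      (closedBall (0 : ℂ) 1 ×ˢ {w : ℂ | w ≠ 0}) := hFs'.add (hradial hκ).contDiffOn
  have hbdry (l : ℂ) (hl : l ∈ sphere (0 : ℂ) 1) : 1 - Complex.normSq l = 0 := by
    have : ‖l‖ = 1 := by simpa using hl
    simp [Complex.normSq_eq_norm_sq, this]
  have hGF (l : ℂ) (hl : l ∈ sphere (0 : ℂ) 1) : G l = F l := by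
    ext w; simp [G, hbdry l hl]
  have hGsmall (l : ℂ) (hl : l ∈ closedBall (0 : ℂ) 1) (w : ℂ)
      (hw : Complex.normSq w < ε ^ 2 / 2) : G l w = Complex.normSq w := by
    simp [G, hκa _ hw, hsmall l hl w (by linarith)]
  let ψ₁ : ℂ → ℂ → ℝ := fun l w => 1 + P (Real.log (G l w))
  have hψ₁s : ContDiffOn ℝ (⊤ : ℕ∞) (fun q : ℂ × ℂ => ψ₁ q.1 q.2)
      (closedBall (0 : ℂ) 1 ×ˢ {w : ℂ | w ≠ 0}) :=
    contDiffOn_const.add (hP.comp_contDiffOn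
      (hGs.log fun q hq => (hκpos q.1 hq.1 q.2 hq.2).ne'))
  have hlap (l : ℂ) (hl : l ∈ closedBall (0 : ℂ) 1) (w : ℂ) (hw : w ≠ 0)
      (h : lap (G l) w < (1 / G l w + 1 + k (G l w)) * gradSq (G l) w) : lap (ψ₁ l) w < 0 := by
    have hG0 : 0 < G l w := hκpos l hl w hw
    have hd (t : ℝ) (ht : 0 < t) :
        HasDerivAt (fun s => 1 + P (Real.log s)) (p (Real.log t) / t) t := by
      simpa [div_eq_mul_inv] using
        ((hPd (Real.log t)).comp t (Real.hasDerivAt_log ht.ne')).const_add 1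
    have h2 : ContDiffAt ℝ 2 (fun s => 1 + P (Real.log s)) (G l w) :=
      contDiffAt_const.add ((hP.contDiffAt.of_le two_le_top).comp _
        (contDiffAt_id.log hG0.ne'))
    have e : lap (ψ₁ l) w =
        -(1 / G l w + 1 + k (G l w)) * (p (Real.log (G l w)) / G l w) * gradSq (G l) w +
          p (Real.log (G l w)) / G l w * lap (G l) w :=
      lap_comp (f := G l) (ρ := fun s => 1 + P (Real.log s))
        (g := fun s => p (Real.log s) / s) (contDiffAt_fibre hUo hGs hl hw) h2
        (by filter_upwards [lt_mem_nhds hG0] with t ht using hd t ht) (hpd _ hG0)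
    rw [e]
    have hq : 0 < p (Real.log (G l w)) / G l w := div_pos (hp0 _) hG0
    nlinarith
  -- Correct the Laplacian over the interior of the disk.
  obtain ⟨κ', hκ', hκ'0, hκ'a, hκ'pos⟩ := exists_positive_correction
    (A := fun l w => -lap (ψ₁ l) w) (continuousOn_lap_fibre hUo hψ₁s).neg (half_pos hε2)
    (fun l hl w hw => neg_pos.2 <| hlap l (sphere_subset_closedBall hl) w hw <| by
      rw [hGF l hl]; exact hklt l hl w hw)
    (fun l hl w hw h => neg_pos.2 <| hlap l hl w hw <| by
      have hev : G l =ᶠ[nhds w] fun z => Complex.normSq z := by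
        filter_upwards [(Complex.continuous_normSq.tendsto w).eventually (gt_mem_nhds h)] with z hz
        exact hGsmall l hl z hz
      have hpos : 0 < Complex.normSq w := Complex.normSq_pos.2 hw
      rw [lap_congr hev, gradSq_congr hev, lap_normSq, gradSq_normSq, hGsmall l hl w h]
      have := hk0 (Complex.normSq w)
      field_simp
      nlinarith)
  obtain ⟨U, hU, hU0, hUlap⟩ := exists_radial hκ' hκ'0 (half_pos (half_pos hε2)) hκ'a
  have hψF (l : ℂ) (hl : l ∈ sphere (0 : ℂ) 1) (w : ℂ) :
      ψ₁ l w + (1 - Complex.normSq l) * U (Complex.normSq w) = 1 + P (Real.log (F l w)) := by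
    simp [ψ₁, hGF l hl, hbdry l hl]
  have hl1 (l : ℂ) (hl : l ∈ closedBall (0 : ℂ) 1) : 0 ≤ 1 - Complex.normSq l := by
    rw [Complex.normSq_eq_norm_sq]
    have : ‖l‖ ≤ 1 := by simpa using hl
    nlinarith [norm_nonneg l]
  have hρ : StrictMonoOn (fun t => 1 + P (Real.log t)) (Ioi 0) := fun x hx y _ hxy =>
    add_lt_add_right (hPmono (Real.log_lt_log hx hxy)) 1
  refine ⟨fun l w => ψ₁ l w + (1 - Complex.normSq l) * U (Complex.normSq w),
    hψ₁s.add (hradial hU).contDiffOn, fun l hl w hw => ?_, fun l hl => ?_,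
    ⟨fun t => 1 + P (Real.log t), hρ, by simp [hP0], fun l hl w _ => hψF l hl w⟩,
    fun l hl w hw => ?_⟩
  · have hUc : ContDiffAt ℝ 2 (fun z => U (Complex.normSq z)) w :=
      ((hU.comp contDiff_normSq).contDiffAt).of_le two_le_top
    rw [lap_add (contDiffAt_fibre hUo hψ₁s hl hw) (contDiffAt_const.mul hUc),
      lap_const_mul _ hUc]
    have h1 := hκ'pos l hl w hw
    have h2 := mul_le_mul_of_nonneg_left (hUlap w) (hl1 l hl)
    linarith
  · have hn : Filter.Tendsto (fun w : ℂ => Complex.normSq w) (nhdsWithin 0 {w : ℂ | w ≠ 0})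
        (nhdsWithin 0 (Ioi 0)) := by
      refine tendsto_nhdsWithin_iff.2 ⟨?_, ?_⟩
      · simpa using (Complex.continuous_normSq.tendsto 0).mono_left nhdsWithin_le_nhds
      · filter_upwards [self_mem_nhdsWithin] with w hw using Complex.normSq_pos.2 hw
    have ht := Filter.tendsto_atBot_add_const_left _ 1
      (hPbot.comp (Real.tendsto_log_nhdsGT_zero.comp hn))
    refine Filter.tendsto_atBot_mono' _ ?_ ht
    have hsm : ∀ᶠ w : ℂ in nhdsWithin 0 {w : ℂ | w ≠ 0}, Complex.normSq w < ε ^ 2 / 2 :=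
      (hn.mono_right nhdsWithin_le_nhds).eventually (gt_mem_nhds (half_pos hε2))
    filter_upwards [hsm] with w hw
    have := mul_nonpos_of_nonneg_of_nonpos (hl1 l hl) (hU0 _ (Complex.normSq_nonneg w))
    simp only [ψ₁, hGsmall l hl w hw, Function.comp]
    linarith
  · simp only [hψF l hl w]
    have h1 : (1 : ℝ) + P (Real.log 1) = 1 := by simp [hP0]
    have := hρ.eq_iff_eq (hF.2.2.2.1 l hl w hw) (mem_Ioi.2 one_pos)
    simpa only [h1] using this
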